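/- Let T be a finite rooted tree with root ε, and for each non-root node n let par(n) denote its parent; let path(n) denote the set of nodes on the path from ε to n (inclusive). Fix d ≥ 1, a real positive definite d × d matrix Σ_ε, and λ ∈ (0,1), and set Σ_n = λ^{depth(n)} Σ_ε where depth(ε) = 0. Let N(x | μ, Σ) = (2π)^{-d/2} (det Σ)^{-1/2} exp(-(1/2)(x-μ)^T Σ^{-1} (x-μ)) denote the multivariate Gaussian density. Suppose vectors A_n, Ã_n ∈ ℝ^d satisfy A_n = Σ_{j ∈ path(n)} Ã_j for every node n. Then N(A_ε | 0, Σ_ε) · Π_{n ≠ ε} N(A_n | A_{par(n)}, Σ_n) = Π_{n ∈ T} N(Ã_n | 0, Σ_n). (This is the prior-equality content of Theorem 1: the TrSLDS hierarchical prior and the residual model's independent prior assign the same joint density.) -/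

import Mathlib

open Matrix

/-- The multivariate Gaussian density
`N(x | μ, Σ) = (2π)^{-d/2} (det Σ)^{-1/2} exp(-(1/2)(x-μ)ᵀ Σ⁻¹ (x-μ))`. -/
noncomputable def gaussDensity {d : ℕ} (x μ : Fin d → ℝ)
    (S : Matrix (Fin d) (Fin d) ℝ) : ℝ :=
  (2 * Real.pi) ^ (-(d : ℝ) / 2) * S.det ^ (-(1 : ℝ) / 2) *
    Real.exp (-(1 / 2) * ((x - μ) ⬝ᵥ (S⁻¹ *ᵥ (x - μ))))

/-- The Gaussian density depends on the point and the mean only through their difference. -/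
theorem gaussDensity_eq_sub_zero {d : ℕ} (x μ : Fin d → ℝ) (S : Matrix (Fin d) (Fin d) ℝ) :
    gaussDensity x μ S = gaussDensity (x - μ) 0 S := by
  simp only [gaussDensity, sub_zero]

/-- **Prior equality content of Theorem 1 (TrSLDS).**  On a finite rooted tree with root `ε`,
parent map `par`, depth `dep`, root-to-node path sets `path`, positive-definite root
covariance `Sε` and covariances `Σ_n = λ^{depth n} Sε` with `λ ∈ (0,1)`, if
`A n = ∑_{j ∈ path n} Ã j` for all nodes `n`, then the hierarchical TrSLDS prior density
equals the residual model's independent prior density. -/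
theorem trslds_prior_equality
    {ι : Type*} [Fintype ι] [DecidableEq ι] {d : ℕ} (hd : 1 ≤ d)
    (ε : ι) (par : ι → ι) (dep : ι → ℕ) (path : ι → Finset ι)
    (hdepε : dep ε = 0)
    (hdep : ∀ n, n ≠ ε → dep n = dep (par n) + 1)
    (hpathε : path ε = {ε})
    (hpath : ∀ n, n ≠ ε → path n = insert n (path (par n)))
    (hnotmem : ∀ n, n ≠ ε → n ∉ path (par n))
    (Sε : Matrix (Fin d) (Fin d) ℝ) (hSε : Sε.PosDef)
    (lam : ℝ) (hlam : lam ∈ Set.Ioo (0 : ℝ) 1)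
    (A At : ι → Fin d → ℝ)
    (hA : ∀ n, A n = ∑ j ∈ path n, At j) :
    gaussDensity (A ε) 0 Sε *
      ∏ n ∈ Finset.univ.erase ε,
        gaussDensity (A n) (A (par n)) (lam ^ dep n • Sε) =
    ∏ n : ι, gaussDensity (At n) 0 (lam ^ dep n • Sε) := by
  rw [← Finset.mul_prod_erase Finset.univ _ (Finset.mem_univ ε)]
  congr 1
  · rw [hA ε, hpathε, Finset.sum_singleton, hdepε, pow_zero, one_smul]
  · refine Finset.prod_congr rfl fun n hn => ?_
    have hne : n ≠ ε := Finset.ne_of_mem_erase hn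
    rw [gaussDensity_eq_sub_zero, hA n, hA (par n), hpath n hne,
      Finset.sum_insert (hnotmem n hne), add_sub_cancel_right]
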